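/- arXiv:2302.13414 — 2 statements merged into one kernel-verified Lean document; each statement's English description precedes it below -/
import Mathlib

section
/- Assume ℓ and u satisfy (SPEC-LU) with u^in = +∞ and ℓ^out ∈ ℝ. Let 𝓗 := {F ∈ 𝓕 : F* ∖ S_0 ⊄ F ∖ S_0}, and set m2' := max_{F ∈ 𝓗} (c(F*) − c(F) + ℓ^out·μ(F ∖ F*))/μ(F* ∖ F) if 𝓗 ≠ ∅, and m2' := 0 otherwise. Then a feasible deviation vector exists if and only if p^{m2' − ℓ^out, ℓ^out}_{ℓ,u,w} is a feasible deviation vector. -/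
open Finset

noncomputable section

variable {S : Type*}

/-- Sum of a real-valued function over a finite subset: `f(X) = ∑_{s∈X} f(s)`. -/
def costSum (c : S → ℝ) (X : Finset S) : ℝ := ∑ s ∈ X, c s

/-- `μ(X) = ∑_{s ∈ X ∖ S₀} 1/w(s)`. -/
def muS [DecidableEq S] (w : S → ℝ) (S0 : Finset S) (X : Finset S) : ℝ :=
  ∑ s ∈ X \ S0, 1 / w s

/-- A deviation vector `p` is feasible if `F*` has minimum `(c−p)`-cost in `𝓕`
and `ℓ ≤ p ≤ u` pointwise. -/
def IsFeasible (𝓕 : Finset (Finset S)) (Fstar : Finset S) (c : S → ℝ)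
    (ℓ u : S → EReal) (p : S → ℝ) : Prop :=
  (∀ F ∈ 𝓕, costSum (fun s => c s - p s) Fstar ≤ costSum (fun s => c s - p s) F) ∧
    (∀ s, ℓ s ≤ (p s : EReal)) ∧ (∀ s, (p s : EReal) ≤ u s)

/-- The special deviation vector `p^{δ,Δ}_{ℓ,u,w}`: the value `(δ+Δ)/w(s)` on `F*`
and `Δ/w(s)` outside `F*`, truncated to `[ℓ(s), u(s)]`. -/
def pdd [DecidableEq S] (Fstar : Finset S) (w : S → ℝ) (ℓ u : S → EReal)
    (δ Δ : ℝ) (s : S) : ℝ :=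
  let v : ℝ := if s ∈ Fstar then (δ + Δ) / w s else Δ / w s
  if (v : EReal) < ℓ s then (ℓ s).toReal
  else if (u s : EReal) < (v : EReal) then (u s).toReal
  else v

/-- The bound functions `ℓ, u` satisfy (SPEC-LU) with data `S₀, ℓ^in, ℓ^out, u^in, u^out`:
`ℓ(s) = u(s) = 0` on `S₀`; `w(s)ℓ(s) = ℓ^in`, `w(s)u(s) = u^in` on `F* ∖ S₀`;
`w(s)ℓ(s) = ℓ^out`, `w(s)u(s) = u^out` outside `F* ∪ S₀`; together with the
ordering conditions of the paper. (`ℓ^in, ℓ^out ∈ ℝ ∪ {−∞}` and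
`u^in, u^out ∈ ℝ ∪ {+∞}`.) -/
def SpecLU [DecidableEq S] (Fstar : Finset S) (w : S → ℝ) (ℓ u : S → EReal)
    (S0 : Finset S) (lin lout uin uout : EReal) : Prop :=
  (∀ s ∈ S0, ℓ s = 0 ∧ u s = 0) ∧
  (∀ s ∈ Fstar, s ∉ S0 → (w s : EReal) * ℓ s = lin ∧ (w s : EReal) * u s = uin) ∧
  (∀ s, s ∉ Fstar → s ∉ S0 → (w s : EReal) * ℓ s = lout ∧ (w s : EReal) * u s = uout) ∧
  lin ≤ uin ∧ lout ≤ uout ∧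
  ((S0 ∩ Fstar).Nonempty → 0 ≤ lin) ∧
  ((S0 \ Fstar).Nonempty → uout ≤ 0) ∧
  (∀ s ∉ Fstar, ∀ t ∈ Fstar,
      (w s : EReal) * lout ≤ (w t : EReal) * lin ∧
      (w s : EReal) * uout ≤ (w t : EReal) * uin) ∧
  lin ≠ ⊤ ∧ lout ≠ ⊤ ∧ uin ≠ ⊥ ∧ uout ≠ ⊥

theorem costSum_sub_le_iff [DecidableEq S] (c p : S → ℝ) (A B : Finset S) :
    costSum (fun s => c s - p s) A ≤ costSum (fun s => c s - p s) B ↔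
      costSum c A - costSum c B ≤ costSum p (A \ B) - costSum p (B \ A) := by
  have h := Finset.sum_sdiff_sub_sum_sdiff (s₁ := A) (s₂ := B) (f := p)
  simp only [costSum, Finset.sum_sub_distrib]
  constructor <;> intro <;> linarith

theorem costSum_sdiff_of_eq_zero [DecidableEq S] {p : S → ℝ} {S0 : Finset S}
    (h0 : ∀ s ∈ S0, p s = 0) (X : Finset S) : costSum p (X \ S0) = costSum p X := by
  refine Finset.sum_subset Finset.sdiff_subset fun s hs hs' => h0 s ?_
  by_contra h
  exact hs' (Finset.mem_sdiff.2 ⟨hs, h⟩)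

theorem costSum_eq_mul_muS [DecidableEq S] {p w : S → ℝ} {S0 X : Finset S} {a : ℝ}
    (h0 : ∀ s ∈ S0, p s = 0) (h : ∀ s ∈ X, s ∉ S0 → p s = a / w s) :
    costSum p X = a * muS w S0 X := by
  rw [← costSum_sdiff_of_eq_zero h0, costSum, muS, Finset.mul_sum]
  refine Finset.sum_congr rfl fun s hs => ?_
  rw [h s (Finset.mem_sdiff.1 hs).1 (Finset.mem_sdiff.1 hs).2, mul_one_div]

theorem mul_muS_le_costSum [DecidableEq S] {p w : S → ℝ} {S0 X : Finset S} {a : ℝ}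
    (h0 : ∀ s ∈ S0, p s = 0) (h : ∀ s ∈ X, s ∉ S0 → a / w s ≤ p s) :
    a * muS w S0 X ≤ costSum p X := by
  rw [← costSum_sdiff_of_eq_zero h0, costSum, muS, Finset.mul_sum]
  refine Finset.sum_le_sum fun s hs => ?_
  rw [mul_one_div]
  exact h s (Finset.mem_sdiff.1 hs).1 (Finset.mem_sdiff.1 hs).2

theorem EReal.eq_coe_div_of_coe_mul_eq {w a : ℝ} (hw : 0 < w) {x : EReal}
    (h : (w : EReal) * x = (a : EReal)) : x = ((a / w : ℝ) : EReal) := by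
  induction x with
  | bot => simp [EReal.coe_mul_bot_of_pos hw] at h
  | top => simp [EReal.coe_mul_top_of_pos hw] at h
  | coe x =>
    norm_cast at h ⊢
    rw [← h]
    field_simp

theorem EReal.eq_top_of_coe_mul_eq_top {w : ℝ} (hw : 0 < w) {x : EReal}
    (h : (w : EReal) * x = ⊤) : x = ⊤ := by
  induction x with
  | bot => simp [EReal.coe_mul_bot_of_pos hw] at h
  | top => rfl
  | coe x => exact absurd h (by rw [← EReal.coe_mul]; exact EReal.coe_ne_top _)

theorem le_pdd_and_pdd_le [DecidableEq S] {Fstar : Finset S} {w : S → ℝ} {ℓ u : S → EReal}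
    (δ Δ : ℝ) {s : S} {q : ℝ} (hl : ℓ s ≤ (q : EReal)) (hu : (q : EReal) ≤ u s) :
    ℓ s ≤ (pdd Fstar w ℓ u δ Δ s : EReal) ∧ (pdd Fstar w ℓ u δ Δ s : EReal) ≤ u s := by
  have hlt : ℓ s ≠ ⊤ := ne_top_of_le_ne_top (EReal.coe_ne_top q) hl
  have hub : u s ≠ ⊥ := ne_bot_of_le_ne_bot (EReal.coe_ne_bot q) hu
  simp only [pdd]
  generalize (if s ∈ Fstar then (δ + Δ) / w s else Δ / w s) = v
  split_ifs with h1 h2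
  · rw [EReal.coe_toReal hlt (ne_bot_of_gt h1)]
    exact ⟨le_rfl, hl.trans hu⟩
  · rw [EReal.coe_toReal (ne_top_of_lt h2) hub]
    exact ⟨hl.trans hu, le_rfl⟩
  · exact ⟨not_lt.1 h1, not_lt.1 h2⟩

theorem div_le_pdd_of_mem [DecidableEq S] {Fstar : Finset S} {w : S → ℝ} {ℓ u : S → EReal}
    (δ Δ : ℝ) {s : S} (hs : s ∈ Fstar) (hl : ℓ s ≠ ⊤) (hu : u s = ⊤) :
    (δ + Δ) / w s ≤ pdd Fstar w ℓ u δ Δ s := by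
  simp only [pdd, hs, if_true, hu, not_top_lt, if_false]
  split_ifs with h
  · rw [← EReal.coe_le_coe_iff, EReal.coe_toReal hl (ne_bot_of_gt h)]
    exact h.le
  · exact le_rfl

theorem pdd_of_notMem [DecidableEq S] {Fstar : Finset S} {w : S → ℝ} {ℓ u : S → EReal}
    (δ Δ : ℝ) {s : S} (hs : s ∉ Fstar) (hl : ℓ s ≤ ((Δ / w s : ℝ) : EReal))
    (hu : ((Δ / w s : ℝ) : EReal) ≤ u s) : pdd Fstar w ℓ u δ Δ s = Δ / w s := by
  simp only [pdd, hs, if_false, not_lt.2 hl, not_lt.2 hu]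

/-- If `ℓ, u` satisfy (SPEC-LU) with `u^in = +∞` and `ℓ^out ∈ ℝ`, then with
`𝓗 = {F ∈ 𝓕 : F* ∖ S₀ ⊄ F ∖ S₀}` and
`m₂' = max_{F ∈ 𝓗} (c(F*) − c(F) + ℓ^out μ(F ∖ F*)) / μ(F* ∖ F)` (or `0` if `𝓗 = ∅`),
a feasible deviation vector exists iff `p^{m₂' − ℓ^out, ℓ^out}_{ℓ,u,w}` is feasible. -/
theorem stmt5 [Fintype S] [DecidableEq S] [Nonempty S]
    (𝓕 : Finset (Finset S)) (Fstar : Finset S) (hFstar : Fstar ∈ 𝓕)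
    (c w : S → ℝ) (hw : ∀ s, 0 < w s)
    (ℓ u : S → EReal) (hlu : ∀ s, ℓ s ≤ u s)
    (S0 : Finset S) (lin uout : EReal) (lout : ℝ)
    (hspec : SpecLU Fstar w ℓ u S0 lin (lout : EReal) ⊤ uout)
    (m2' : ℝ)
    (hm2 : m2' =
      if h : (𝓕.filter fun F => ¬ (Fstar \ S0 ⊆ F \ S0)).Nonempty then
        (𝓕.filter fun F => ¬ (Fstar \ S0 ⊆ F \ S0)).sup' h fun F =>
          (costSum c Fstar - costSum c F + lout * muS w S0 (F \ Fstar)) /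
            muS w S0 (Fstar \ F)
      else 0) :
    (∃ p : S → ℝ, IsFeasible 𝓕 Fstar c ℓ u p) ↔
      IsFeasible 𝓕 Fstar c ℓ u (pdd Fstar w ℓ u (m2' - lout) lout) := by
  refine ⟨?_, fun h => ⟨_, h⟩⟩
  rintro ⟨q, hq, hql, hqu⟩
  obtain ⟨hS0, hin, hout, -⟩ := hspec
  have eq_zero {r : S → ℝ} (hl : ∀ s, ℓ s ≤ (r s : EReal)) (hu : ∀ s, (r s : EReal) ≤ u s) :
      ∀ s ∈ S0, r s = 0 := fun s hs => by
    have h1 := hl s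
    have h2 := hu s
    rw [(hS0 s hs).1] at h1
    rw [(hS0 s hs).2] at h2
    exact_mod_cast le_antisymm h2 h1
  have hbd s := le_pdd_and_pdd_le (Fstar := Fstar) (w := w) (m2' - lout) lout (hql s) (hqu s)
  have hpin : ∀ s ∈ Fstar, s ∉ S0 → m2' / w s ≤ pdd Fstar w ℓ u (m2' - lout) lout s := by
    intro s hs hs0
    have h := div_le_pdd_of_mem (w := w) (m2' - lout) lout hs
      (ne_top_of_le_ne_top (EReal.coe_ne_top _) (hql s))
      (EReal.eq_top_of_coe_mul_eq_top (hw s) (hin s hs hs0).2)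
    rwa [sub_add_cancel] at h
  have hℓout : ∀ s ∉ Fstar, s ∉ S0 → ℓ s = ((lout / w s : ℝ) : EReal) := fun s hs hs0 =>
    EReal.eq_coe_div_of_coe_mul_eq (hw s) (hout s hs hs0).1
  have hpout : ∀ s ∉ Fstar, s ∉ S0 → pdd Fstar w ℓ u (m2' - lout) lout s = lout / w s :=
    fun s hs hs0 => pdd_of_notMem _ _ hs (hℓout s hs hs0).le (hℓout s hs hs0 ▸ hlu s)
  refine ⟨fun F hF => ?_, fun s => (hbd s).1, fun s => (hbd s).2⟩
  have hp0 := eq_zero (fun s => (hbd s).1) (fun s => (hbd s).2)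
  have hq0 := eq_zero hql hqu
  generalize pdd Fstar w ℓ u (m2' - lout) lout = p at *
  rw [costSum_sub_le_iff, costSum_eq_mul_muS (X := F \ Fstar) hp0
    fun s hs => hpout s (Finset.mem_sdiff.1 hs).2]
  by_cases hFH : Fstar \ S0 ⊆ F \ S0
  · have hsub : ∀ s ∈ Fstar \ F, s ∈ S0 := fun s hs => by
      rw [Finset.mem_sdiff] at hs
      by_contra h
      exact hs.2 (Finset.mem_sdiff.1 (hFH (Finset.mem_sdiff.2 ⟨hs.1, h⟩))).1
    have hpz : costSum p (Fstar \ F) = 0 := Finset.sum_eq_zero fun s hs => hp0 s (hsub s hs)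
    have hqz : costSum q (Fstar \ F) = 0 := Finset.sum_eq_zero fun s hs => hq0 s (hsub s hs)
    have hqF := (costSum_sub_le_iff c q Fstar F).1 (hq F hF)
    have hqout : lout * muS w S0 (F \ Fstar) ≤ costSum q (F \ Fstar) :=
      mul_muS_le_costSum hq0 fun s hs hs0 => by
        have h := hql s
        rw [hℓout s (Finset.mem_sdiff.1 hs).2 hs0] at h
        exact_mod_cast h
    linarith
  · have hmem : F ∈ 𝓕.filter fun F => ¬ (Fstar \ S0 ⊆ F \ S0) :=
      Finset.mem_filter.2 ⟨hF, hFH⟩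
    have hpos : 0 < muS w S0 (Fstar \ F) := by
      obtain ⟨s, hs, hsF⟩ := Finset.not_subset.1 hFH
      refine Finset.sum_pos (fun t _ => one_div_pos.2 (hw t)) ⟨s, ?_⟩
      simp only [Finset.mem_sdiff] at hs hsF ⊢
      tauto
    rw [dif_pos ⟨F, hmem⟩] at hm2
    have hle := Finset.le_sup' (fun F =>
      (costSum c Fstar - costSum c F + lout * muS w S0 (F \ Fstar)) /
        muS w S0 (Fstar \ F)) hmem
    rw [← hm2, div_le_iff₀ hpos] at hle
    have hple : m2' * muS w S0 (Fstar \ F) ≤ costSum p (Fstar \ F) :=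
      mul_muS_le_costSum hp0 fun s hs => hpin s (Finset.mem_sdiff.1 hs).1
    linarith
end
end

section
/- For every feasible deviation vector p, all j1, j2 ∈ {1,…,k}, and all F', F''' ∈ 𝓕 with (1/w)(F') < (1/w)(F*) < (1/w)(F'''), one has spa_w(p) ≥ [ (c^{j1}(F*) − c^{j1}(F'))/((1/w)(F*) − (1/w)(F')) − (c^{j2}(F*) − c^{j2}(F'''))/((1/w)(F*) − (1/w)(F''')) ] / [ (1/w)(F* ∖ F')/((1/w)(F*) − (1/w)(F')) − (1/w)(F* ∖ F''')/((1/w)(F*) − (1/w)(F''')) ]. -/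
open Finset

noncomputable section

variable {S : Type*}

/-- `(1/w)(X) = ∑_{s∈X} 1/w(s)`. -/
def invw (w : S → ℝ) (X : Finset S) : ℝ := ∑ s ∈ X, 1 / w s

/-- The weighted span `spa_w(p) = max_{s∈S} w(s)p(s) − min_{s∈S} w(s)p(s)`. -/
def spa [Fintype S] [Nonempty S] (w p : S → ℝ) : ℝ :=
  (univ.sup' univ_nonempty fun s => w s * p s) -
    (univ.inf' univ_nonempty fun s => w s * p s)

/-- A deviation vector `p` is feasible (no bound constraints) for the cost
functions `c^1, …, c^k` if `F*` has minimum `(c^j − p)`-cost in `𝓕` for all `j`. -/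
def FeasibleU (𝓕 : Finset (Finset S)) (Fstar : Finset S) {k : ℕ}
    (c : Fin k → S → ℝ) (p : S → ℝ) : Prop :=
  ∀ j : Fin k, ∀ F ∈ 𝓕,
    costSum (fun s => c j s - p s) Fstar ≤ costSum (fun s => c j s - p s) F

theorem costSum_sdiff_sub_sdiff [DecidableEq S] (f : S → ℝ) (A B : Finset S) :
    costSum f (A \ B) - costSum f (B \ A) = costSum f A - costSum f B :=
  sum_sdiff_sub_sum_sdiff

theorem invw_sdiff_sub_sdiff [DecidableEq S] (w : S → ℝ) (A B : Finset S) :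
    invw w (A \ B) - invw w (B \ A) = invw w A - invw w B :=
  sum_sdiff_sub_sum_sdiff

theorem invw_nonneg {w : S → ℝ} (hw : ∀ s, 0 < w s) (X : Finset S) : 0 ≤ invw w X :=
  sum_nonneg fun s _ => (one_div_pos.2 (hw s)).le

theorem costSum_le_mul_invw {w p : S → ℝ} (hw : ∀ s, 0 < w s) {M : ℝ}
    (hM : ∀ s, w s * p s ≤ M) (X : Finset S) : costSum p X ≤ M * invw w X := by
  unfold costSum invw
  rw [mul_sum]
  refine sum_le_sum fun s _ => ?_
  rw [mul_one_div, le_div_iff₀ (hw s), mul_comm]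
  exact hM s

theorem mul_invw_le_costSum {w p : S → ℝ} (hw : ∀ s, 0 < w s) {m : ℝ}
    (hm : ∀ s, m ≤ w s * p s) (X : Finset S) : m * invw w X ≤ costSum p X := by
  unfold costSum invw
  rw [mul_sum]
  refine sum_le_sum fun s _ => ?_
  rw [mul_one_div, div_le_iff₀ (hw s), mul_comm (p s)]
  exact hm s

/-- For feasible `p`, the cost difference of `F*` and `F` is bounded in terms of the weighted span
and the minimum of `w * p`. -/
theorem FeasibleU.costSum_sub_le [Fintype S] [DecidableEq S] [Nonempty S]
    {𝓕 : Finset (Finset S)} {Fstar : Finset S} {k : ℕ} {c : Fin k → S → ℝ} {w p : S → ℝ}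
    (hp : FeasibleU 𝓕 Fstar c p) (hw : ∀ s, 0 < w s) (j : Fin k) {F : Finset S} (hF : F ∈ 𝓕) :
    costSum (c j) Fstar - costSum (c j) F ≤
      spa w p * invw w (Fstar \ F) +
        (univ.inf' univ_nonempty fun s => w s * p s) * (invw w Fstar - invw w F) := by
  have hc : costSum (c j) Fstar - costSum p Fstar ≤ costSum (c j) F - costSum p F := by
    simpa only [costSum, sum_sub_distrib] using hp j F hF
  have hupper := costSum_le_mul_invw hw (M := univ.sup' univ_nonempty fun s => w s * p s)
    (fun s => le_sup' (fun s => w s * p s) (mem_univ s)) (Fstar \ F)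
  have hlower := mul_invw_le_costSum hw (m := univ.inf' univ_nonempty fun s => w s * p s)
    (fun s => inf'_le (fun s => w s * p s) (mem_univ s)) (F \ Fstar)
  have hsplit := costSum_sdiff_sub_sdiff p Fstar F
  rw [← invw_sdiff_sub_sdiff w Fstar F, spa]
  linarith

/-- For every feasible deviation vector `p`, all `j₁, j₂`, and all `F', F''' ∈ 𝓕`
with `(1/w)(F') < (1/w)(F*) < (1/w)(F''')`, the weighted span of `p` is at least
the ratio appearing in the min–max theorem. -/
theorem stmt10 [Fintype S] [DecidableEq S] [Nonempty S]
    (𝓕 : Finset (Finset S)) (Fstar : Finset S) (hFstar : Fstar ∈ 𝓕)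
    (k : ℕ) (hk : 1 ≤ k) (c : Fin k → S → ℝ)
    (w : S → ℝ) (hw : ∀ s, 0 < w s)
    (p : S → ℝ) (hp : FeasibleU 𝓕 Fstar c p)
    (j1 j2 : Fin k) (F' F''' : Finset S) (hF' : F' ∈ 𝓕) (hF''' : F''' ∈ 𝓕)
    (h1 : invw w F' < invw w Fstar) (h2 : invw w Fstar < invw w F''') :
    ((costSum (c j1) Fstar - costSum (c j1) F') / (invw w Fstar - invw w F') -
     (costSum (c j2) Fstar - costSum (c j2) F''') / (invw w Fstar - invw w F''')) /
      (invw w (Fstar \ F') / (invw w Fstar - invw w F') -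
       invw w (Fstar \ F''') / (invw w Fstar - invw w F''')) ≤ spa w p := by
  have hd1 : 0 < invw w Fstar - invw w F' := sub_pos.2 h1
  have hd2 : invw w Fstar - invw w F''' < 0 := sub_neg.2 h2
  have hnum1 := div_le_div_of_nonneg_right (hp.costSum_sub_le hw j1 hF') hd1.le
  have hnum2 := div_le_div_of_nonpos_of_le hd2.le (hp.costSum_sub_le hw j2 hF''')
  rw [add_div, mul_div_cancel_right₀ _ hd1.ne', mul_div_assoc] at hnum1
  rw [add_div, mul_div_cancel_right₀ _ hd2.ne, mul_div_assoc] at hnum2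
  have ha1 : 0 < invw w (Fstar \ F') := by
    have hnonneg := invw_nonneg hw (F' \ Fstar)
    have hsplit := invw_sdiff_sub_sdiff w Fstar F'
    linarith
  have hpos := div_pos ha1 hd1
  have hnonpos := div_nonpos_of_nonneg_of_nonpos (invw_nonneg hw (Fstar \ F''')) hd2.le
  rw [div_le_iff₀ (by linarith), mul_sub]
  linarith
end
end
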